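/- arXiv:0708.0511 — 3 statements merged into one kernel-verified Lean document; each statement's English description precedes it below -/
import Mathlib

section
/- (Kernel characterisation in the nonresonant case.) Let λ, ω₂, …, ω_d ∈ ℝ with λ ≠ 0, and assume ω₂,…,ω_d are nonresonant: k₂ω₂ + … + k_dω_d ≠ 0 for every (k₂,…,k_d) ∈ ℤ^{d−1} \ {0}. Set H₂ := λ·x₁ξ₁ + i·Σ_{k=2}^d ω_k·x_k ξ_k. Then for j ∈ ℕ and multi-indices α, β ∈ ℕ^d one has {H₂, ħ^j x^α ξ^β} = 0 if and only if α = β. Consequently, for every odd s, the only A ∈ 𝒲^s with {H₂, A} = 0 is A = 0. -/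
open MvPolynomial

/-- Variables of the polynomial ring `R = ℂ[ħ, q₁, …, q_d, p₁, …, p_d]`:
`PVar.h` is `ħ`, `PVar.q k` is `q_k` and `PVar.p k` is `p_k`. -/
inductive PVar (d : ℕ) : Type where
  | h : PVar d
  | q : Fin d → PVar d
  | p : Fin d → PVar d
  deriving DecidableEq

/-- The commutative polynomial ring `R = ℂ[ħ, q₁, …, q_d, p₁, …, p_d]`. -/
abbrev Rpoly (d : ℕ) : Type := MvPolynomial (PVar d) ℂ

/-- `ħ` as an element of `R`. -/
noncomputable def hbar (d : ℕ) : Rpoly d := X PVar.h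

/-- The formal partial derivative with respect to a variable, as a linear endomorphism. -/
noncomputable def pd {d : ℕ} (v : PVar d) : Module.End ℂ (Rpoly d) :=
  (pderiv v).toLinearMap

/-- Iterated partial derivative `∂^μ` with respect to the family of variables `f`. -/
noncomputable def pdMulti {d : ℕ} (f : Fin d → PVar d) (μ : Fin d → ℕ) :
    Module.End ℂ (Rpoly d) :=
  (List.ofFn fun k => pd (f k) ^ μ k).prod

/-- The bidifferential operator
`P^n(A,B) = Σ_{μ,ν ∈ ℕ^d, |μ|+|ν|=n} (n!/(μ!·ν!)) (−1)^{|ν|} (∂_q^μ ∂_p^ν A)·(∂_p^μ ∂_q^ν B)`.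
(Any multi-index contributing to the sum has all entries `≤ n`, so the sum below over
`μ ν : Fin d → Fin (n+1)` captures exactly the nonzero part of this sum.) -/
noncomputable def Pop {d : ℕ} (n : ℕ) (A B : Rpoly d) : Rpoly d :=
  ∑ μ : Fin d → Fin (n + 1), ∑ ν : Fin d → Fin (n + 1),
    if (∑ k, (μ k : ℕ)) + (∑ k, (ν k : ℕ)) = n then
      C (((n.factorial : ℂ) /
            (((∏ k, Nat.factorial (μ k)) * ∏ k, Nat.factorial (ν k) : ℕ) : ℂ)) *
          (-1 : ℂ) ^ (∑ k, (ν k : ℕ))) *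
        pdMulti PVar.q (fun k => (μ k : ℕ)) (pdMulti PVar.p (fun k => (ν k : ℕ)) A) *
        pdMulti PVar.p (fun k => (μ k : ℕ)) (pdMulti PVar.q (fun k => (ν k : ℕ)) B)
    else 0

/-- The Poisson bracket `{A,B} = P^1(A,B) = Σ_k (∂_{q_k}A·∂_{p_k}B − ∂_{p_k}A·∂_{q_k}B)`. -/
noncomputable def poisson {d : ℕ} (A B : Rpoly d) : Rpoly d :=
  ∑ k : Fin d, (pd (PVar.q k) A * pd (PVar.p k) B - pd (PVar.p k) A * pd (PVar.q k) B)

/-- The Moyal bracket `{A,B}_M = Σ_{k≥0} ((−1)^k (ħ/2)^{2k}/(2k+1)!) P^{2k+1}(A,B)`.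
On polynomials this series is a finite sum: all terms with `2k+1` exceeding the total
degree vanish, so the truncation below equals the full series. -/
noncomputable def moyal {d : ℕ} (A B : Rpoly d) : Rpoly d :=
  ∑ k ∈ Finset.range (A.totalDegree + B.totalDegree + 1),
    C ((-1 : ℂ) ^ k / ((2 * k + 1).factorial : ℂ)) *
      (C (1 / 2 : ℂ) * hbar d) ^ (2 * k) * Pop (2 * k + 1) A B

/-- The Moyal star product `A⋆B = Σ_{k≥0} (1/k!)(iħ/2)^k P^k(A,B)`.
On polynomials this series is a finite sum: all terms with `k` exceeding the total
degree vanish, so the truncation below equals the full series. -/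
noncomputable def starP {d : ℕ} (A B : Rpoly d) : Rpoly d :=
  ∑ k ∈ Finset.range (A.totalDegree + B.totalDegree + 1),
    C ((k.factorial : ℂ))⁻¹ * (C (Complex.I / 2) * hbar d) ^ k * Pop k A B

/-- The Moyal adjoint `Mad_W A = {W,A}_M`. -/
noncomputable def Mad {d : ℕ} (W A : Rpoly d) : Rpoly d := moyal W A

/-- The weight of a variable: `q_k, p_k` have weight 1, `ħ` has weight 2. -/
def wtv {d : ℕ} : PVar d → ℕ
  | .h => 2
  | .q _ => 1
  | .p _ => 1

/-- The weight `2j + |α| + |β|` of a monomial `ħ^j q^α p^β` with exponent data `m`. -/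
def wt {d : ℕ} (m : PVar d →₀ ℕ) : ℕ := m.sum fun v e => wtv v * e

/-- The space `𝒲^s`: the ℂ-linear span of the monomials `ħ^j q^α p^β` with
`2j+|α|+|β| = s`; it is `{0}` for `s < 0`. -/
noncomputable def Wgr (d : ℕ) (s : ℤ) : Submodule ℂ (Rpoly d) :=
  Submodule.span ℂ {P : Rpoly d | ∃ m : PVar d →₀ ℕ, (wt m : ℤ) = s ∧ P = monomial m 1}

/-- The quadratic part `H₂ = λ·x₁ξ₁ + i·Σ_{k=2}^d ω_k·x_k ξ_k` at a nonresonant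
saddle-centre-⋯-centre equilibrium point, written in the complexified coordinates.
Here the polynomial ring has `d+1` degrees of freedom: `PVar.q k` plays the role of
`x_{k+1}` and `PVar.p k` the role of `ξ_{k+1}`; the saddle variable has index `0` and
the `d` centre frequencies are `ω i`, `i : Fin d`. -/
noncomputable def H2saddle (d : ℕ) (lam : ℝ) (ω : Fin d → ℝ) : Rpoly (d + 1) :=
  C (lam : ℂ) * X (PVar.q 0) * X (PVar.p 0) +
    ∑ i : Fin d, C (Complex.I * (ω i : ℂ)) * X (PVar.q i.succ) * X (PVar.p i.succ)

/-- The monomial `ħ^j x^α ξ^β`. -/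
noncomputable def mono (d : ℕ) (j : ℕ) (α β : Fin (d + 1) → ℕ) : Rpoly (d + 1) :=
  hbar (d + 1) ^ j * (∏ k, X (PVar.q k) ^ α k) * ∏ k, X (PVar.p k) ^ β k

/-- The exponent vector of the monomial `ħ^j q^α p^β`. -/
noncomputable def expVec {d : ℕ} (j : ℕ) (α β : Fin d → ℕ) : PVar d →₀ ℕ :=
  Finsupp.single PVar.h j + ∑ k, Finsupp.single (PVar.q k) (α k) +
    ∑ k, Finsupp.single (PVar.p k) (β k)

@[simp]
lemma expVec_h {d : ℕ} (j : ℕ) (α β : Fin d → ℕ) : expVec j α β PVar.h = j := by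
  simp [expVec]

@[simp]
lemma expVec_q {d : ℕ} (j : ℕ) (α β : Fin d → ℕ) (k : Fin d) :
    expVec j α β (PVar.q k) = α k := by
  simp [expVec, Finsupp.single_apply]

@[simp]
lemma expVec_p {d : ℕ} (j : ℕ) (α β : Fin d → ℕ) (k : Fin d) :
    expVec j α β (PVar.p k) = β k := by
  simp [expVec, Finsupp.single_apply]

lemma expVec_self {d : ℕ} (m : PVar d →₀ ℕ) :
    expVec (m PVar.h) (fun k => m (PVar.q k)) (fun k => m (PVar.p k)) = m := by
  ext v
  cases v <;> simp

lemma mono_eq_monomial (d : ℕ) (j : ℕ) (α β : Fin (d + 1) → ℕ) :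
    mono d j α β = monomial (expVec j α β) 1 := by
  simp only [mono, hbar, expVec, X_pow_eq_monomial, ← monomial_sum_one, monomial_mul, mul_one]

lemma wt_add {d : ℕ} (m n : PVar d →₀ ℕ) : wt (m + n) = wt m + wt n :=
  Finsupp.sum_add_index' (fun _ => mul_zero _) (fun _ => mul_add _)

lemma wt_single {d : ℕ} (v : PVar d) (e : ℕ) : wt (Finsupp.single v e) = wtv v * e :=
  Finsupp.sum_single_index (mul_zero _)

lemma wt_sum {d : ℕ} {ι : Type*} (s : Finset ι) (f : ι → PVar d →₀ ℕ) :
    wt (∑ i ∈ s, f i) = ∑ i ∈ s, wt (f i) :=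
  map_sum (⟨⟨wt, Finsupp.sum_zero_index⟩, wt_add⟩ : (PVar d →₀ ℕ) →+ ℕ) f s

lemma wt_expVec {d : ℕ} (j : ℕ) (α β : Fin d → ℕ) :
    wt (expVec j α β) = 2 * j + ∑ k, α k + ∑ k, β k := by
  simp [expVec, wt_add, wt_sum, wt_single, wtv]

lemma even_wt_of_q_eq_p {d : ℕ} {m : PVar d →₀ ℕ} (h : ∀ k, m (PVar.q k) = m (PVar.p k)) :
    Even (wt m) := by
  rw [← expVec_self m, wt_expVec]
  simp only [h]
  exact ⟨m PVar.h + ∑ k, m (PVar.p k), by ring⟩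

lemma wt_eq_of_mem_Wgr {d : ℕ} {s : ℤ} {A : Rpoly d} (hA : A ∈ Wgr d s) {m : PVar d →₀ ℕ}
    (hm : coeff m A ≠ 0) : (wt m : ℤ) = s := by
  induction hA using Submodule.span_induction with
  | mem P hP =>
    obtain ⟨n, hn, rfl⟩ := hP
    rw [coeff_monomial] at hm
    split_ifs at hm with h
    · exact h ▸ hn
    · exact absurd rfl hm
  | zero => simp at hm
  | add P Q _ _ ihP ihQ =>
    by_cases hP : coeff m P = 0
    · exact ihQ fun hQ => hm (by rw [coeff_add, hP, hQ, add_zero])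
    · exact ihP hP
  | smul c P _ ih => exact ih fun hP => hm (by rw [coeff_smul, hP, smul_zero])

/-- The quadratic Hamiltonian `Σ_k c_k q_k p_k`. -/
noncomputable def diagQuadratic {d : ℕ} (c : Fin d → ℂ) : Rpoly d :=
  ∑ k, C (c k) * X (PVar.q k) * X (PVar.p k)

lemma pd_apply {d : ℕ} (v : PVar d) (A : Rpoly d) : pd v A = pderiv v A := rfl

lemma pd_q_diagQuadratic {d : ℕ} (c : Fin d → ℂ) (k : Fin d) :
    pd (PVar.q k) (diagQuadratic c) = C (c k) * X (PVar.p k) := by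
  simp [pd_apply, diagQuadratic, pderiv_X, Pi.single_apply, mul_comm]

lemma pd_p_diagQuadratic {d : ℕ} (c : Fin d → ℂ) (k : Fin d) :
    pd (PVar.p k) (diagQuadratic c) = C (c k) * X (PVar.q k) := by
  simp [pd_apply, diagQuadratic, pderiv_X, Pi.single_apply]

lemma poisson_add_right {d : ℕ} (A B B' : Rpoly d) :
    poisson A (B + B') = poisson A B + poisson A B' := by
  simp only [poisson, map_add, ← Finset.sum_add_distrib]
  exact Finset.sum_congr rfl fun k _ => by ring

/-- The eigenvalue of `{Σ_k c_k q_k p_k, ·}` on the monomial with exponent vector `m`. -/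
noncomputable def bracketEigenvalue {d : ℕ} (c : Fin d → ℂ) (m : PVar d →₀ ℕ) : ℂ :=
  ∑ k, c k * ((m (PVar.p k) : ℂ) - m (PVar.q k))

lemma poisson_diagQuadratic_monomial {d : ℕ} (c : Fin d → ℂ) (m : PVar d →₀ ℕ) (a : ℂ) :
    poisson (diagQuadratic c) (monomial m a) = monomial m (bracketEigenvalue c m * a) := by
  rw [poisson, bracketEigenvalue, Finset.sum_mul, map_sum]
  refine Finset.sum_congr rfl fun k _ => ?_
  rw [pd_q_diagQuadratic, pd_p_diagQuadratic, mul_assoc, mul_assoc]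
  simp only [pd_apply, X_mul_pderiv_monomial,
    ← Nat.cast_smul_eq_nsmul ℂ, smul_monomial, C_mul_monomial, ← map_sub, smul_eq_mul]
  congr 1
  ring

lemma coeff_poisson_diagQuadratic {d : ℕ} (c : Fin d → ℂ) (A : Rpoly d) (m : PVar d →₀ ℕ) :
    coeff m (poisson (diagQuadratic c) A) = bracketEigenvalue c m * coeff m A := by
  induction A using MvPolynomial.induction_on' with
  | monomial n a =>
    rw [poisson_diagQuadratic_monomial, coeff_monomial, coeff_monomial]
    split_ifs with h
    · rw [h]
    · rw [mul_zero]
  | add P Q hP hQ => rw [poisson_add_right, coeff_add, hP, hQ, coeff_add, mul_add]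

/-- The coefficients `λ, iω₂, …` of the saddle-centre quadratic part. -/
noncomputable def saddleCoeff {d : ℕ} (lam : ℝ) (ω : Fin d → ℝ) : Fin (d + 1) → ℂ :=
  Fin.cons (lam : ℂ) fun i => Complex.I * (ω i : ℂ)

lemma H2saddle_eq_diagQuadratic (d : ℕ) (lam : ℝ) (ω : Fin d → ℝ) :
    H2saddle d lam ω = diagQuadratic (saddleCoeff lam ω) := by
  simp [H2saddle, diagQuadratic, saddleCoeff, Fin.sum_univ_succ]

lemma bracketEigenvalue_saddleCoeff_eq_zero_iff {d : ℕ} {lam : ℝ} (hlam : lam ≠ 0)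
    {ω : Fin d → ℝ} (hres : ∀ m : Fin d → ℤ, m ≠ 0 → ∑ i : Fin d, (m i : ℝ) * ω i ≠ 0)
    (m : PVar (d + 1) →₀ ℕ) :
    bracketEigenvalue (saddleCoeff lam ω) m = 0 ↔ ∀ k, m (PVar.q k) = m (PVar.p k) := by
  refine ⟨fun h => ?_, fun h => by simp [bracketEigenvalue, h]⟩
  set n : Fin (d + 1) → ℤ := fun k => (m (PVar.p k) : ℤ) - m (PVar.q k) with hn
  have key : bracketEigenvalue (saddleCoeff lam ω) m =
      ((lam * n 0 : ℝ) : ℂ) + ((∑ i : Fin d, (n i.succ : ℝ) * ω i : ℝ) : ℂ) * Complex.I := by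
    simp only [bracketEigenvalue, saddleCoeff, Fin.sum_univ_succ, Fin.cons_zero, Fin.cons_succ, hn]
    push_cast
    rw [Finset.sum_mul]
    congr 1
    exact Finset.sum_congr rfl fun i _ => by ring
  rw [key, ← Complex.mk_eq_add_mul_I] at h
  have hre : lam * (n 0 : ℝ) = 0 := congrArg Complex.re h
  have him : ∑ i : Fin d, (n i.succ : ℝ) * ω i = 0 := congrArg Complex.im h
  have h0 : n 0 = 0 := by exact_mod_cast (mul_eq_zero.mp hre).resolve_left hlam
  have hsucc : (fun i : Fin d => n i.succ) = 0 := by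
    by_contra hne
    exact hres _ hne him
  intro k
  have hk : n k = 0 := by
    induction k using Fin.cases with
    | zero => exact h0
    | succ i => exact congrFun hsucc i
  simp only [hn] at hk
  lia

/-- Kernel characterisation in the nonresonant case. Assume `λ ≠ 0`
and the frequencies are nonresonant (no nontrivial integer combination vanishes). Then
`{H₂, ħ^j x^α ξ^β} = 0` if and only if `α = β`; consequently, for every odd `s`, the
only `A ∈ 𝒲^s` with `{H₂, A} = 0` is `A = 0`. -/
theorem kernel_characterisation (d : ℕ) (lam : ℝ) (hlam : lam ≠ 0) (ω : Fin d → ℝ)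
    (hres : ∀ m : Fin d → ℤ, m ≠ 0 → ∑ i : Fin d, (m i : ℝ) * ω i ≠ 0) :
    (∀ (j : ℕ) (α β : Fin (d + 1) → ℕ),
        poisson (H2saddle d lam ω) (mono d j α β) = 0 ↔ α = β) ∧
    (∀ s : ℤ, Odd s → ∀ A ∈ Wgr (d + 1) s,
        poisson (H2saddle d lam ω) A = 0 → A = 0) := by
  rw [H2saddle_eq_diagQuadratic]
  refine ⟨fun j α β => ?_, fun s hs A hA hzero => ?_⟩
  · rw [mono_eq_monomial, poisson_diagQuadratic_monomial, mul_one, monomial_eq_zero,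
      bracketEigenvalue_saddleCoeff_eq_zero_iff hlam hres]
    simp [funext_iff]
  · ext m
    rw [coeff_zero]
    by_contra hm
    have hev := coeff_poisson_diagQuadratic (saddleCoeff lam ω) A m
    rw [hzero, coeff_zero, eq_comm, mul_eq_zero, or_iff_left hm,
      bracketEigenvalue_saddleCoeff_eq_zero_iff hlam hres] at hev
    rw [← wt_eq_of_mem_Wgr hA hm, Int.odd_coe_nat] at hs
    exact Nat.not_odd_iff_even.mpr (even_wt_of_q_eq_p hev) hs
end

section
/- (Moyal-adjoint equals adjoint to leading order in ħ.) For every W, A ∈ R and every n ≥ 0, the difference (Mad_W)^n A − (ad_W)^n A is divisible by ħ² in R, i.e. there exists C ∈ R with (Mad_W)^n A − (ad_W)^n A = ħ²·C. (This is the key step showing that the principal symbol of the N-th order quantum normal form is the N-th order classical normal form.) -/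
open MvPolynomial

theorem List.prod_ofFn_pow_single {M : Type*} [Monoid M] {d : ℕ} (a : Fin d → M) (j : Fin d) :
    (List.ofFn fun k => a k ^ (Pi.single j 1 : Fin d → ℕ) k).prod = a j := by
  induction d with
  | zero => exact j.elim0
  | succ d ih =>
    rw [List.ofFn_succ, List.prod_cons]
    induction j using Fin.cases with
    | zero => simp [List.ofFn_const]
    | succ j =>
      have h := ih (fun k => a k.succ) j
      simp only [Pi.single_apply, Fin.succ_inj] at h ⊢
      rw [h, if_neg (Fin.succ_ne_zero j).symm, pow_zero, one_mul]

theorem pdMulti_single {d : ℕ} (f : Fin d → PVar d) (j : Fin d) :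
    pdMulti f (Pi.single j 1) = pd (f j) :=
  List.prod_ofFn_pow_single (fun k => pd (f k)) j

theorem pdMulti_zero {d : ℕ} (f : Fin d → PVar d) : pdMulti f 0 = 1 := by
  simp [pdMulti, List.ofFn_const]

theorem Fin.val_comp_pi_single {d : ℕ} (j : Fin d) :
    (fun k => ((Pi.single j 1 : Fin d → Fin 2) k : ℕ)) = Pi.single j 1 := by
  ext k
  by_cases h : k = j <;> simp [h]

theorem Fin.exists_eq_pi_single_of_sum_eq_one {d : ℕ} (μ : Fin d → Fin 2)
    (h : ∑ k, (μ k : ℕ) = 1) : ∃ j, μ = Pi.single j 1 := by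
  obtain ⟨j, -, hj⟩ : ∃ j ∈ Finset.univ, (μ j : ℕ) ≠ 0 :=
    Finset.exists_ne_zero_of_sum_ne_zero (by omega)
  refine ⟨j, funext fun k => Fin.ext ?_⟩
  rw [← Finset.add_sum_erase _ _ (Finset.mem_univ j)] at h
  by_cases hk : k = j
  · subst hk
    simp only [Pi.single_eq_same, Fin.val_one]
    omega
  · have hle := Finset.single_le_sum (f := fun i => (μ i : ℕ)) (fun _ _ => Nat.zero_le _)
      (Finset.mem_erase.2 ⟨hk, Finset.mem_univ k⟩)
    simp only [Pi.single_eq_of_ne hk, Fin.val_zero]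
    omega

theorem Fin.eq_zero_of_sum_val_eq_zero {d : ℕ} (μ : Fin d → Fin 2)
    (h : ∑ k, (μ k : ℕ) = 0) : μ = 0 :=
  funext fun k => Fin.ext (Finset.sum_eq_zero_iff.1 h k (Finset.mem_univ k))

/-- The pairs of multi-indices of total order one, indexed by the position of the entry `1`. -/
def orderOnePair {d : ℕ} : Fin d ⊕ Fin d → (Fin d → Fin 2) × (Fin d → Fin 2) :=
  Sum.elim (fun k => (Pi.single k 1, 0)) (fun k => (0, Pi.single k 1))

theorem orderOnePair_injective {d : ℕ} : Function.Injective (orderOnePair (d := d)) := by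
  rintro (i | i) (j | j) h <;>
    simp only [orderOnePair, Sum.elim_inl, Sum.elim_inr, Prod.mk.injEq] at h
  · have := congrFun h.1 i
    by_cases hij : i = j <;> simp_all
  · have := congrFun h.1 i
    simp at this
  · have := congrFun h.2 i
    simp at this
  · have := congrFun h.2 i
    by_cases hij : i = j <;> simp_all

theorem Pop_one {d : ℕ} (A B : Rpoly d) : Pop 1 A B = poisson A B := by
  have hone (j : Fin d) : ∑ k, (Pi.single j 1 : Fin d → ℕ) k = 1 := by simp
  have hfac (j : Fin d) : ∏ k, ((Pi.single j 1 : Fin d → ℕ) k).factorial = 1 :=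
    Finset.prod_eq_one fun k _ => by by_cases h : k = j <;> simp [h]
  have hzero : (fun k => ((0 : Fin d → Fin 2) k : ℕ)) = 0 := rfl
  rw [Pop, ← Fintype.sum_prod_type', poisson, Finset.sum_sub_distrib, sub_eq_add_neg,
    ← Finset.sum_neg_distrib]
  symm
  refine (Fintype.sum_sum_type (Sum.elim (fun k => pd (PVar.q k) A * pd (PVar.p k) B)
    (fun k => -(pd (PVar.p k) A * pd (PVar.q k) B)))).symm.trans ?_
  refine Fintype.sum_of_injective orderOnePair orderOnePair_injective _ _ ?_ ?_
  · rintro ⟨μ, ν⟩ hμν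
    refine if_neg fun h => hμν ?_
    rcases Nat.add_eq_one_iff.1 h with ⟨h0, h1⟩ | ⟨h1, h0⟩
    · obtain ⟨j, rfl⟩ := Fin.exists_eq_pi_single_of_sum_eq_one ν h1
      exact ⟨Sum.inr j, by rw [Fin.eq_zero_of_sum_val_eq_zero μ h0]; rfl⟩
    · obtain ⟨j, rfl⟩ := Fin.exists_eq_pi_single_of_sum_eq_one μ h1
      exact ⟨Sum.inl j, by rw [Fin.eq_zero_of_sum_val_eq_zero ν h0]; rfl⟩
  · have hval (j k : Fin d) : ((Pi.single j 1 : Fin d → Fin 2) k : ℕ) =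
        (Pi.single j 1 : Fin d → ℕ) k := congrFun (Fin.val_comp_pi_single j) k
    rintro (j | j) <;>
      simp only [orderOnePair, Sum.elim_inl, Sum.elim_inr, hzero, hval, hone, hfac] <;>
      simp [pdMulti_single, pdMulti_zero]

theorem exists_moyal_eq_poisson_add {d : ℕ} (A B : Rpoly d) :
    ∃ D : Rpoly d, moyal A B = poisson A B + hbar d ^ 2 * D := by
  obtain ⟨D, hD⟩ : hbar d ^ 2 ∣ ∑ k ∈ Finset.range (A.totalDegree + B.totalDegree),
      C ((-1 : ℂ) ^ (k + 1) / ((2 * (k + 1) + 1).factorial : ℂ)) *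
        (C (1 / 2 : ℂ) * hbar d) ^ (2 * (k + 1)) * Pop (2 * (k + 1) + 1) A B := by
    refine Finset.dvd_sum fun k _ => Dvd.dvd.mul_right (Dvd.dvd.mul_left ?_ _) _
    rw [mul_pow]
    exact Dvd.dvd.mul_left (pow_dvd_pow _ (by omega)) _
  refine ⟨D, ?_⟩
  rw [moyal, Finset.sum_range_succ', hD, add_comm, ← Pop_one]
  simp

theorem poisson_add_hbar_sq_mul {d : ℕ} (W A D : Rpoly d) :
    poisson W (A + hbar d ^ 2 * D) = poisson W A + hbar d ^ 2 * poisson W D := by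
  have hq (k : Fin d) : pderiv (PVar.q k) (hbar d) = 0 := pderiv_X_of_ne (by simp)
  have hp (k : Fin d) : pderiv (PVar.p k) (hbar d) = 0 := pderiv_X_of_ne (by simp)
  have hpd (v : PVar d) (P : Rpoly d) : pd v P = pderiv v P := rfl
  simp only [poisson, hpd, Finset.mul_sum, ← Finset.sum_add_distrib]
  refine Finset.sum_congr rfl fun k _ => ?_
  simp only [map_add, pderiv_mul, pderiv_pow,
    hq, hp]
  ring

/-- For every `W, A ∈ R` and every `n ≥ 0` the difference
`(Mad_W)^n A − (ad_W)^n A` is divisible by `ħ²`, where `Mad_W = {W,·}_M` and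
`ad_W = {W,·}` (Poisson). -/
theorem mad_iter_sub_ad_iter_dvd_hbar_sq {d : ℕ} (W A : Rpoly d) (n : ℕ) :
    ∃ C' : Rpoly d,
      (Mad W)^[n] A - (fun B => poisson W B)^[n] A = hbar d ^ 2 * C' := by
  induction n with
  | zero => exact ⟨0, by simp⟩
  | succ n ih =>
    obtain ⟨E, hE⟩ := ih
    obtain ⟨D, hD⟩ := exists_moyal_eq_poisson_add W ((Mad W)^[n] A)
    refine ⟨poisson W E + D, ?_⟩
    rw [Function.iterate_succ_apply', Function.iterate_succ_apply', Mad, hD,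
      eq_add_of_sub_eq' hE, poisson_add_hbar_sq_mul]
    ring
end

section
/- (Star-product recursion for the centre integral.) Let d = 1 and J := (p² + q²)/2 ∈ R. Then for every n ≥ 1, J ⋆ Jⁿ = J^{n+1} − (ħ/2)²·n²·J^{n−1}. -/
open MvPolynomial

/-- The classical integral `J = (p² + q²)/2` for one degree of freedom. -/
noncomputable def Jcen : Rpoly 1 := C (1 / 2 : ℂ) * (X (PVar.p 0) ^ 2 + X (PVar.q 0) ^ 2)

theorem pdMulti_one (f : Fin 1 → PVar 1) (μ : Fin 1 → ℕ) :
    pdMulti f μ = pd (f 0) ^ μ 0 := by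
  simp [pdMulti]

/-- In one degree of freedom the multi-index sum is a sum over pairs of natural numbers. -/
theorem Pop_one_s15 (n : ℕ) (A B : Rpoly 1) :
    Pop n A B = ∑ a : Fin (n + 1), ∑ b : Fin (n + 1),
      if (a : ℕ) + b = n then
        C ((n.factorial : ℂ) / (((a : ℕ).factorial * (b : ℕ).factorial : ℕ) : ℂ) *
            (-1 : ℂ) ^ (b : ℕ)) *
          (pd (PVar.q 0) ^ (a : ℕ)) ((pd (PVar.p 0) ^ (b : ℕ)) A) *
          (pd (PVar.p 0) ^ (a : ℕ)) ((pd (PVar.q 0) ^ (b : ℕ)) B)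
      else 0 := by
  simp only [Pop, pdMulti_one, Fin.sum_univ_one, Fin.prod_univ_one]
  refine Fintype.sum_equiv (Equiv.funUnique (Fin 1) (Fin (n + 1))) _ _ fun μ => ?_
  exact Fintype.sum_equiv (Equiv.funUnique (Fin 1) (Fin (n + 1))) _ _ fun ν => rfl

theorem C_half_add_C_half {σ : Type*} : (C (1 / 2 : ℂ) + C (1 / 2) : MvPolynomial σ ℂ) = 1 := by
  rw [← C_add]
  norm_num

theorem pd_q_Jcen : pd (PVar.q 0) Jcen = X (PVar.q 0) := by
  simp [pd, Jcen, Derivation.leibniz, Derivation.leibniz_pow, -one_div]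
  linear_combination X (PVar.q 0) * C_half_add_C_half (σ := PVar 1)

theorem pd_p_Jcen : pd (PVar.p 0) Jcen = X (PVar.p 0) := by
  simp [pd, Jcen, Derivation.leibniz, Derivation.leibniz_pow, -one_div]
  linear_combination X (PVar.p 0) * C_half_add_C_half (σ := PVar 1)

theorem pd_X_self (v : PVar 1) : pd v (X v) = 1 := pderiv_X_self v

theorem pd_X_of_ne {v w : PVar 1} (h : w ≠ v) : pd v (X w) = 0 := pderiv_X_of_ne h

theorem pd_one (v : PVar 1) : pd v 1 = 0 := pderiv_one

theorem pd_mul (v : PVar 1) (A B : Rpoly 1) : pd v (A * B) = A * pd v B + pd v A * B := by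
  simp [pd, Derivation.leibniz, mul_comm B]

theorem pd_pow (v : PVar 1) (A : Rpoly 1) (n : ℕ) :
    pd v (A ^ n) = (n : Rpoly 1) * A ^ (n - 1) * pd v A := by
  simp [pd, Derivation.leibniz_pow, mul_assoc]

theorem pd_natCast (v : PVar 1) (n : ℕ) : pd v (n : Rpoly 1) = 0 := by
  simp [pd]

/-- All derivatives of `J` of order at least three vanish. -/
theorem pd_pow_pd_pow_Jcen {a b : ℕ} (h : 3 ≤ a + b) :
    (pd (PVar.q 0) ^ a) ((pd (PVar.p 0) ^ b) Jcen) = 0 := by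
  match b with
  | 0 =>
    obtain ⟨c, rfl⟩ : ∃ c, a = c + 3 := ⟨a - 3, by omega⟩
    simp [pow_succ, pd_q_Jcen, pd_X_self, pd_one]
  | 1 =>
    obtain ⟨c, rfl⟩ : ∃ c, a = c + 1 := ⟨a - 1, by omega⟩
    simp [pow_succ, pd_p_Jcen, pd_X_of_ne]
  | 2 =>
    obtain ⟨c, rfl⟩ : ∃ c, a = c + 1 := ⟨a - 1, by omega⟩
    simp [pow_succ, pd_p_Jcen, pd_X_self, pd_one]
  | b + 3 =>
    simp [pow_succ, pd_p_Jcen, pd_X_self, pd_one]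

theorem Pop_Jcen_eq_zero {k : ℕ} (hk : 3 ≤ k) (B : Rpoly 1) : Pop k Jcen B = 0 := by
  rw [Pop_one_s15]
  refine Finset.sum_eq_zero fun a _ => Finset.sum_eq_zero fun b _ => ?_
  split_ifs with h
  · rw [pd_pow_pd_pow_Jcen (by omega)]
    simp
  · rfl

theorem Pop_zero_one (A B : Rpoly 1) : Pop 0 A B = A * B := by
  simp [Pop_one_s15]

theorem Pop_one_Jcen (n : ℕ) : Pop 1 Jcen (Jcen ^ n) = 0 := by
  simp [Pop_one_s15, Fin.sum_univ_two, pd_pow, pd_q_Jcen, pd_p_Jcen]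
  ring

theorem Pop_two_Jcen (n : ℕ) :
    Pop 2 Jcen (Jcen ^ (n + 1)) = 2 * C (((n + 1 : ℕ) : ℂ) ^ 2) * Jcen ^ n := by
  have hJ : (X (PVar.p 0) ^ 2 + X (PVar.q 0) ^ 2 : Rpoly 1) = 2 * Jcen := by
    rw [Jcen]
    linear_combination -(X (PVar.p 0) ^ 2 + X (PVar.q 0) ^ 2) * C_half_add_C_half (σ := PVar 1)
  simp [Pop_one_s15, Fin.sum_univ_three, pow_two, pd_pow, pd_q_Jcen, pd_p_Jcen, pd_X_self,
    pd_X_of_ne, pd_mul, pd_natCast, pd_one]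
  rcases n with _ | n
  · simp
    ring
  · simp only [Nat.add_sub_cancel, Nat.cast_add, Nat.cast_one]
    linear_combination ((n : Rpoly 1) + 2) * (n + 1) * Jcen ^ n * hJ

theorem two_le_totalDegree_Jcen : 2 ≤ Jcen.totalDegree := by
  have h : Finsupp.single (PVar.p 0) 2 ∈ Jcen.support := by
    rw [mem_support_iff, Jcen, coeff_C_mul, coeff_add, coeff_X_pow, coeff_X_pow]
    simp [Finsupp.single_left_inj]
  simpa using le_totalDegree h

/-- Star-product recursion for the centre integral. For `n ≥ 1`,
`J ⋆ Jⁿ = J^{n+1} − (ħ/2)²·n²·J^{n−1}`. -/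
theorem star_recursion_J (n : ℕ) (hn : 1 ≤ n) :
    starP Jcen (Jcen ^ n) =
      Jcen ^ (n + 1) -
        (C (1 / 2 : ℂ) * hbar 1) ^ 2 * C ((n : ℂ) ^ 2) * Jcen ^ (n - 1) := by
  obtain ⟨n, rfl⟩ : ∃ m, n = m + 1 := ⟨n - 1, by omega⟩
  have hsub : Finset.range 3 ⊆
      Finset.range (Jcen.totalDegree + (Jcen ^ (n + 1)).totalDegree + 1) :=
    Finset.range_subset_range.2 (by have := two_le_totalDegree_Jcen; omega)
  rw [starP, ← Finset.sum_subset hsub fun k _ hk => by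
    rw [Pop_Jcen_eq_zero (by simpa using hk), mul_zero]]
  have hI : (C (Complex.I / 2) : Rpoly 1) ^ 2 = -C (1 / 2) ^ 2 := by
    rw [← C_pow, ← C_pow, ← C_neg]
    congr 1
    linear_combination (1 / 4 : ℂ) * Complex.I_sq
  have h2 : (C ((Nat.factorial 2 : ℕ) : ℂ)⁻¹ : Rpoly 1) * 2 = 1 := by
    have := C_half_add_C_half (σ := PVar 1)
    norm_num [Nat.factorial] at this ⊢
    linear_combination this
  simp only [Finset.sum_range_succ, Finset.sum_range_zero, Pop_zero_one, Pop_one_Jcen,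
    Pop_two_Jcen, Nat.add_sub_cancel, Nat.factorial_zero, Nat.cast_one, inv_one, C_1]
  linear_combination (C (Complex.I / 2) * hbar 1) ^ 2 * C (((n + 1 : ℕ) : ℂ) ^ 2) * Jcen ^ n * h2 +
    hbar 1 ^ 2 * C (((n + 1 : ℕ) : ℂ) ^ 2) * Jcen ^ n * hI
end
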